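/- arXiv:2401.09371 — 5 statements merged into one kernel-verified Lean document; each statement's English description precedes it below -/
import Mathlib

section
/- Let N be an even positive integer and let r : ℤ → ℂ satisfy r[n] = 0 for n ∉ {−N/2, …, N/2}. Then for every half-bandwidth parameter W ∈ (0, 1/2] and all l, m ∈ ℕ, the tail energy bound can be tightened as follows: Ē_{−l,m}(B_W^{1/2} r) ≤ Ē_{−2l,2m}(B_{W/2}(r↑2)) − Σ_{i=1}^{2} | Σ_{n=−N/2}^{N/2} r[n]·sinc(W(−2l − i − 2n)) |². -/
open scoped BigOperators

/-- normalized sinc: sinc(x) = sin(πx)/(πx) for x ≠ 0, sinc(0) = 1. -/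
noncomputable def sinc (x : ℝ) : ℝ :=
  if x = 0 then 1 else Real.sin (Real.pi * x) / (Real.pi * x)

/-- Fractional shift / band-limiting operator `B_W^τ` acting on a sequence. -/
noncomputable def fracShift (W τ : ℝ) (r : ℤ → ℂ) (n : ℤ) : ℂ :=
  ∑' q : ℤ, r q * (sinc (2 * W * ((n : ℝ) - τ - (q : ℝ))) : ℂ)

/-- 2-fold upsampling of a sequence. -/
noncomputable def upsample2 (r : ℤ → ℂ) (n : ℤ) : ℂ :=
  if Even n then r (n / 2) else 0

/-- Tail energy `Ē_{-l,m}(r) = Σ_{n ≤ -l-1} |r n|² + Σ_{n ≥ m+1} |r n|²`. -/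
noncomputable def tailEnergy (l m : ℕ) (r : ℤ → ℂ) : ℝ :=
  (∑' k : ℕ, ‖r (-(l : ℤ) - 1 - (k : ℤ))‖ ^ 2) + ∑' k : ℕ, ‖r ((m : ℤ) + 1 + (k : ℤ))‖ ^ 2

theorem summable_sinc_mul_intCast_sq {W : ℝ} (hW : 0 < W) :
    Summable fun n : ℤ => sinc (W * n) ^ 2 := by
  have h : Summable fun n : ℤ => (1 / (Real.pi * W)) ^ 2 * (1 / (n : ℝ) ^ 2) :=
    (Real.summable_one_div_int_pow.mpr one_lt_two).mul_left _
  refine h.of_norm_bounded_eventually ?_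
  filter_upwards [(Set.finite_singleton (0 : ℤ)).compl_mem_cofinite] with n hn
  have hn : (n : ℝ) ≠ 0 := by simpa using hn
  rw [sinc, if_neg (mul_ne_zero hW.ne' hn), Real.norm_of_nonneg (sq_nonneg _), div_pow]
  calc Real.sin (Real.pi * (W * n)) ^ 2 / (Real.pi * (W * n)) ^ 2
      ≤ 1 / (Real.pi * (W * n)) ^ 2 := by
        gcongr
        exact Real.sin_sq_le_one _
    _ = (1 / (Real.pi * W)) ^ 2 * (1 / (n : ℝ) ^ 2) := by
        rw [← mul_assoc, mul_pow, div_pow, one_pow, one_div_mul_one_div]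

theorem fracShift_eq_sum {r : ℤ → ℂ} {S : Finset ℤ} (hr : ∀ n ∉ S, r n = 0) (W τ : ℝ) (n : ℤ) :
    fracShift W τ r n = ∑ q ∈ S, r q * (sinc (2 * W * ((n : ℝ) - τ - (q : ℝ))) : ℂ) :=
  tsum_eq_sum fun q hq => by rw [hr q hq, zero_mul]

theorem fracShift_zero_upsample2 {r : ℤ → ℂ} {S : Finset ℤ} (hr : ∀ n ∉ S, r n = 0)
    (W : ℝ) (n : ℤ) :
    fracShift (W / 2) 0 (upsample2 r) n
      = ∑ q ∈ S, r q * (sinc (W * ((n : ℝ) - 2 * (q : ℝ))) : ℂ) := by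
  have hu : ∀ k ∉ S.image (2 * ·), upsample2 r k = 0 := by
    intro k hk
    rw [upsample2]
    split_ifs with he
    · refine hr _ fun h => hk (Finset.mem_image.mpr ⟨_, h, Int.two_mul_ediv_two_of_even he⟩)
    · rfl
  rw [fracShift_eq_sum hu, Finset.sum_image fun a _ b _ h => by simpa using h]
  refine Finset.sum_congr rfl fun q _ => ?_
  have hq : upsample2 r (2 * q) = r q := by simp [upsample2]
  rw [hq]
  congr 3
  push_cast
  ring

theorem fracShift_half_eq_fracShift_upsample2 {r : ℤ → ℂ} {S : Finset ℤ}
    (hr : ∀ n ∉ S, r n = 0) (W : ℝ) (n : ℤ) :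
    fracShift W (1 / 2) r n = fracShift (W / 2) 0 (upsample2 r) (2 * n - 1) := by
  rw [fracShift_eq_sum hr, fracShift_zero_upsample2 hr]
  refine Finset.sum_congr rfl fun q _ => ?_
  congr 3
  push_cast
  ring

theorem summable_norm_sq_fracShift_upsample2 {r : ℤ → ℂ} {S : Finset ℤ}
    (hr : ∀ n ∉ S, r n = 0) {W : ℝ} (hW : 0 < W) :
    Summable fun n : ℤ => ‖fracShift (W / 2) 0 (upsample2 r) n‖ ^ 2 := by
  have hs (q : ℤ) :
      Summable fun n : ℤ => ‖r q * (sinc (W * ((n : ℝ) - 2 * (q : ℝ))) : ℂ)‖ ^ 2 := by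
    have h := (Equiv.subRight (2 * q)).summable_iff.mpr (summable_sinc_mul_intCast_sq hW)
    refine (h.mul_left (‖r q‖ ^ 2)).congr fun n => ?_
    rw [norm_mul, mul_pow, Complex.norm_real, Real.norm_eq_abs, sq_abs]
    simp
  refine ((summable_sum fun q (_ : q ∈ S) => hs q).mul_left (S.card : ℝ)).of_nonneg_of_le
    (fun n => sq_nonneg _) fun n => ?_
  rw [fracShift_zero_upsample2 hr]
  calc _ ≤ (∑ q ∈ S, ‖r q * (sinc (W * ((n : ℝ) - 2 * (q : ℝ))) : ℂ)‖) ^ 2 := by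
        gcongr
        exact norm_sum_le _ _
    _ ≤ _ := sq_sum_le_card_mul_sum_sq

/-- Sampling the tails of a nonnegative summable sequence at odd indices, the first two terms of the
left tail may be discarded. -/
theorem tsum_odd_tails_le {g : ℤ → ℝ} (hg : Summable g) (h0 : ∀ n, 0 ≤ g n) (l m : ℕ) :
    (∑' k : ℕ, g (2 * (-(l : ℤ) - 1 - k) - 1)) + ∑' k : ℕ, g (2 * ((m : ℤ) + 1 + k) - 1)
      ≤ (∑' k : ℕ, g (-((2 * l : ℕ) : ℤ) - 1 - k)) + (∑' k : ℕ, g (((2 * m : ℕ) : ℤ) + 1 + k))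
        - (g (-2 * l - 1) + g (-2 * l - 2)) := by
  have hL : Summable fun k : ℕ => g (-((2 * l : ℕ) : ℤ) - 1 - k) :=
    hg.comp_injective fun a b h => by simpa using h
  have hR : Summable fun k : ℕ => g (((2 * m : ℕ) : ℤ) + 1 + k) :=
    hg.comp_injective fun a b h => by simpa using h
  have hL' := (summable_nat_add_iff 2).mpr hL
  have h2 : Function.Injective fun k : ℕ => 2 * k := fun a b h => by simpa using h
  have hle {f : ℕ → ℝ} (hf : Summable f) (hf0 : ∀ k, 0 ≤ f k) : ∑' k, f (2 * k) ≤ ∑' k, f k :=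
    (hf.comp_injective h2).tsum_le_tsum_of_inj _ h2 (fun k _ => hf0 k) (fun _ => le_rfl) hf
  have hleft := hle hL' fun k => h0 _
  have hright := hle hR fun k => h0 _
  have hsplit := hL.sum_add_tsum_nat_add 2
  rw [Finset.sum_range_succ, Finset.sum_range_one] at hsplit
  have e1 : (fun k : ℕ => g (2 * (-(l : ℤ) - 1 - k) - 1))
      = fun k : ℕ => g (-((2 * l : ℕ) : ℤ) - 1 - ((2 * k + 2 : ℕ) : ℤ)) := by
    funext k; congr 1; push_cast; ring
  have e2 : (fun k : ℕ => g (2 * ((m : ℤ) + 1 + k) - 1))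
      = fun k : ℕ => g (((2 * m : ℕ) : ℤ) + 1 + ((2 * k : ℕ) : ℤ)) := by
    funext k; congr 1; push_cast; ring
  have e3 : (-2 * l - 1 : ℤ) = -((2 * l : ℕ) : ℤ) - 1 - (0 : ℕ) := by push_cast; ring
  have e4 : (-2 * l - 2 : ℤ) = -((2 * l : ℕ) : ℤ) - 1 - (1 : ℕ) := by push_cast; ring
  rw [e1, e2, e3, e4]
  linarith

/-- tightened tail-energy bound for index-limited sequences. -/
theorem tailEnergy_half_shift_le_sub
    (N : ℕ) (hN : 0 < N) (hNe : Even N)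
    (r : ℤ → ℂ) (hr : ∀ n : ℤ, n ∉ Finset.Icc (-(N : ℤ)/2) ((N : ℤ)/2) → r n = 0)
    (W : ℝ) (hW : W ∈ Set.Ioc (0 : ℝ) (1/2)) (l m : ℕ) :
    tailEnergy l m (fracShift W (1/2) r)
      ≤ tailEnergy (2*l) (2*m) (fracShift (W/2) 0 (upsample2 r))
        - ∑ i ∈ Finset.Icc (1 : ℤ) 2,
            ‖∑ n ∈ Finset.Icc (-(N : ℤ)/2) ((N : ℤ)/2),
                r n * (sinc (W * (-2*(l : ℝ) - (i : ℝ) - 2*(n : ℝ))) : ℂ)‖ ^ 2 := by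
  have hterm (i : ℤ) : ∑ n ∈ Finset.Icc (-(N : ℤ)/2) ((N : ℤ)/2),
      r n * (sinc (W * (-2*(l : ℝ) - (i : ℝ) - 2*(n : ℝ))) : ℂ)
      = fracShift (W / 2) 0 (upsample2 r) (-2 * l - i) := by
    rw [fracShift_zero_upsample2 hr]
    push_cast
    rfl
  have hIcc : Finset.Icc (1 : ℤ) 2 = {1, 2} := by decide
  simp only [hterm, hIcc, tailEnergy, fracShift_half_eq_fracShift_upsample2 hr]
  rw [Finset.sum_pair (by norm_num)]
  exact tsum_odd_tails_le (summable_norm_sq_fracShift_upsample2 hr hW.1)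
    (fun n => sq_nonneg _) l m
end

section
/- Let N ∈ ℕ, W ∈ (0,1), and let s : ℤ → ℝ satisfy s[n] = 0 for n ∉ {−N,…,N} and Σ_{m=−N}^{N} s[m]² = 1. Suppose λ ∈ ℝ is such that λ·s[n] = Σ_{m=−N}^{N} W·sinc(W(n−m))·s[m] holds for all n ∈ {−N,…,N} (i.e., s restricted to {−N,…,N} is a unit eigenvector of the DPSS matrix K with eigenvalue λ). Define the band-limited extension b[n] := Σ_{m=−N}^{N} s[m]·sinc(W(n−m)) for all n ∈ ℤ. Then the tail energy of b outside {−N,…,N} equals Σ_{n ≤ −N−1} b[n]² + Σ_{n ≥ N+1} b[n]² = λ(1−λ)/W². -/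
open scoped BigOperators

lemma sinc_neg (x : ℝ) : sinc (-x) = sinc x := by
  simp [sinc, neg_div_neg_eq]

lemma integral_exp_band (W : ℝ) (k : ℤ) :
    ∫ x in (-(W / 2))..(W / 2), Complex.exp (2 * Real.pi * Complex.I * k * x)
      = ((W * sinc (W * k) : ℝ) : ℂ) := by
  by_cases hk : k = 0
  · subst hk
    simp [sinc]
  by_cases hW : W = 0
  · simp [hW]
  have hπ : (Real.pi : ℂ) ≠ 0 := by exact_mod_cast Real.pi_ne_zero
  have hkC : (k : ℂ) ≠ 0 := by exact_mod_cast hk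
  have hWC : (W : ℂ) ≠ 0 := by exact_mod_cast hW
  have hkR : (k : ℝ) ≠ 0 := by exact_mod_cast hk
  rw [integral_exp_mul_complex (by simp [hπ, hkC]), sinc, if_neg (mul_ne_zero hW hkR)]
  push_cast
  rw [Complex.sin, show 2 * (Real.pi : ℂ) * Complex.I * k * (W / 2)
      = Real.pi * (W * k) * Complex.I by ring,
    show 2 * (Real.pi : ℂ) * Complex.I * k * (-(W / 2))
      = -(Real.pi * (W * k)) * Complex.I by ring]
  field_simp
  rw [Complex.I_sq]
  ring

lemma integral_indicator_band {W : ℝ} (hW : W ∈ Set.Ioo (0 : ℝ) 1) (G : ℝ → ℂ) :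
    ∫ x in (-(1 / 2 : ℝ))..(1 / 2), (Set.Ioc (-(W / 2)) (W / 2)).indicator G x
      = ∫ x in (-(W / 2))..(W / 2), G x := by
  obtain ⟨h0, h1⟩ := hW
  rw [intervalIntegral.integral_of_le (by norm_num), intervalIntegral.integral_of_le (by linarith),
    MeasureTheory.setIntegral_indicator measurableSet_Ioc,
    Set.inter_eq_right.2 (Set.Ioc_subset_Ioc (by linarith) (by linarith))]

/-- Parseval's identity for the band-limited extension of a finitely supported sequence. -/
lemma hasSum_sq_bandlimited {W : ℝ} (hW : W ∈ Set.Ioo (0 : ℝ) 1) (A : Finset ℤ) (c : ℤ → ℝ) :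
    HasSum (fun n : ℤ => (W * ∑ m ∈ A, c m * sinc (W * ((n : ℝ) - m))) ^ 2)
      (∑ n ∈ A, ∑ m ∈ A, c n * c m * (W * sinc (W * ((n : ℝ) - m)))) := by
  set S : ℝ → ℂ := fun x => ∑ m ∈ A, (c m : ℂ) * Complex.exp (2 * Real.pi * Complex.I * m * x)
    with hS
  have hcont : Continuous S := by fun_prop
  set f : ℝ → ℂ := (Set.Ioc (-(W / 2)) (W / 2)).indicator S with hf
  have hab : (-(1 / 2) : ℝ) < 1 / 2 := by norm_num
  have hbound : ∀ x, ‖S x‖ ≤ ∑ m ∈ A, |c m| := by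
    intro x
    refine (norm_sum_le _ _).trans (Finset.sum_le_sum fun m _ => ?_)
    rw [norm_mul, Complex.norm_real, Real.norm_eq_abs, Complex.norm_exp]
    simp
  have hL2 : MeasureTheory.MemLp f 2
      (MeasureTheory.volume.restrict (Set.Ioc (-(1 / 2) : ℝ) (1 / 2))) := by
    refine MeasureTheory.MemLp.of_bound
      (hcont.aestronglyMeasurable.indicator measurableSet_Ioc) (∑ m ∈ A, |c m|)
      (Filter.Eventually.of_forall fun x => ?_)
    exact (norm_indicator_le_norm_self _ _).trans (hbound x)
  have hcoeff : ∀ n : ℤ, fourierCoeffOn hab f n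
      = ((W * ∑ m ∈ A, c m * sinc (W * ((n : ℝ) - m)) : ℝ) : ℂ) := by
    intro n
    rw [fourierCoeffOn_eq_integral]
    have hfun : ∀ x : ℝ, fourier (-n) (x : AddCircle (1 / 2 - -(1 / 2) : ℝ)) • f x
        = (Set.Ioc (-(W / 2)) (W / 2)).indicator (fun x : ℝ => ∑ m ∈ A, (c m : ℂ) *
            Complex.exp (2 * Real.pi * Complex.I * ((m - n : ℤ) : ℂ) * x)) x := by
      intro x
      by_cases hx : x ∈ Set.Ioc (-(W / 2)) (W / 2)
      · rw [hf, Set.indicator_of_mem hx, Set.indicator_of_mem hx, fourier_coe_apply, hS,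
          smul_eq_mul, Finset.mul_sum]
        refine Finset.sum_congr rfl fun m _ => ?_
        rw [mul_left_comm, ← Complex.exp_add]
        congr 2
        push_cast
        ring
      · rw [hf, Set.indicator_of_notMem hx, Set.indicator_of_notMem hx, smul_zero]
    simp_rw [hfun]
    rw [integral_indicator_band hW, intervalIntegral.integral_finsetSum
      fun m _ => Continuous.intervalIntegrable (by fun_prop) _ _]
    simp_rw [intervalIntegral.integral_const_mul, integral_exp_band]
    rw [show (1 / (1 / 2 - -(1 / 2)) : ℝ) = 1 by norm_num, one_smul, Finset.mul_sum]
    push_cast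
    refine Finset.sum_congr rfl fun m _ => ?_
    rw [← sinc_neg, ← mul_neg, neg_sub]
    ring
  have hint : ((∫ x in (-(1 / 2 : ℝ))..(1 / 2), ‖f x‖ ^ 2 : ℝ) : ℂ)
      = ((∑ n ∈ A, ∑ m ∈ A, c n * c m * (W * sinc (W * ((n : ℝ) - m))) : ℝ) : ℂ) := by
    rw [← intervalIntegral.integral_ofReal]
    have hfun : ∀ x : ℝ, ((‖f x‖ ^ 2 : ℝ) : ℂ)
        = (Set.Ioc (-(W / 2)) (W / 2)).indicator (fun x : ℝ => ∑ n ∈ A, ∑ m ∈ A,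
            ((c n * c m : ℝ) : ℂ) *
              Complex.exp (2 * Real.pi * Complex.I * ((n - m : ℤ) : ℂ) * x)) x := by
      intro x
      by_cases hx : x ∈ Set.Ioc (-(W / 2)) (W / 2)
      · rw [hf, Set.indicator_of_mem hx, Set.indicator_of_mem hx, Complex.ofReal_pow,
          ← Complex.mul_conj', hS, map_sum, Finset.sum_mul_sum]
        refine Finset.sum_congr rfl fun n _ => Finset.sum_congr rfl fun m _ => ?_
        rw [map_mul, Complex.conj_ofReal, ← Complex.exp_conj, mul_mul_mul_comm,
          ← Complex.exp_add, ← Complex.ofReal_mul]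
        congr 2
        simp only [map_mul, Complex.conj_I, Complex.conj_ofReal, map_intCast, map_ofNat]
        push_cast
        ring
      · rw [hf, Set.indicator_of_notMem hx, Set.indicator_of_notMem hx]
        simp
    simp_rw [hfun]
    rw [integral_indicator_band hW, intervalIntegral.integral_finsetSum
      fun n _ => Continuous.intervalIntegrable (by fun_prop) _ _]
    push_cast
    refine Finset.sum_congr rfl fun n _ => ?_
    rw [intervalIntegral.integral_finsetSum
      fun m _ => Continuous.intervalIntegrable (by fun_prop) _ _]
    refine Finset.sum_congr rfl fun m _ => ?_
    have := integral_exp_band W (n - m)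
    push_cast at this
    rw [intervalIntegral.integral_const_mul, this]
  have key := hasSum_sq_fourierCoeffOn hab hL2
  rw [Complex.ofReal_injective hint] at key
  simpa only [hcoeff, Complex.norm_real, Real.norm_eq_abs, sq_abs,
    show ((1 / 2 - -(1 / 2) : ℝ))⁻¹ = 1 by norm_num, one_smul] using key

lemma tsum_tails_eq {F : ℤ → ℝ} {a : ℝ} (hF : HasSum F a) (N : ℕ) :
    (∑' k : ℕ, F (-(N : ℤ) - 1 - k)) + ∑' k : ℕ, F ((N : ℤ) + 1 + k)
      = a - ∑ n ∈ Finset.Icc (-(N : ℤ)) N, F n := by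
  set A := Finset.Icc (-(N : ℤ)) N with hA
  set G : ℤ → ℝ := fun n => if n ∈ A then 0 else F n with hG
  have hGsum : HasSum G (a - ∑ n ∈ A, F n) := by
    have h1 : HasSum (fun n => if n ∈ A then F n else 0) (∑ n ∈ A, if n ∈ A then F n else 0) :=
      hasSum_sum_of_ne_finset_zero fun n hn => if_neg hn
    rw [Finset.sum_congr rfl fun n hn => if_pos hn] at h1
    refine (hF.sub h1).congr_fun fun n => ?_
    by_cases hn : n ∈ A <;> simp [hG, hn]
  have hnat : Summable fun k : ℕ => G k :=
    hGsum.summable.comp_injective Nat.cast_injective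
  have hneg : Summable fun k : ℕ => G (-(k + 1)) :=
    hGsum.summable.comp_injective (i := fun k : ℕ => -((k : ℤ) + 1)) fun x y h => by
      simpa using h
  rw [← hGsum.tsum_eq, tsum_of_nat_of_neg_add_one hnat hneg,
    ← hnat.sum_add_tsum_nat_add (N + 1), ← hneg.sum_add_tsum_nat_add N,
    Finset.sum_eq_zero (s := Finset.range (N + 1)), Finset.sum_eq_zero (s := Finset.range N),
    zero_add, zero_add, add_comm]
  · congr 1 <;> refine tsum_congr fun k => ?_
    · have hk : ((k + (N + 1) : ℕ) : ℤ) ∉ A := by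
        rw [hA, Finset.mem_Icc]
        lia
      rw [hG]
      simp only [hk, if_false]
      congr 1
      push_cast
      ring
    · have hk : -(((k + N : ℕ) : ℤ) + 1) ∉ A := by
        rw [hA, Finset.mem_Icc]
        lia
      rw [hG]
      simp only [hk, if_false]
      congr 1
      push_cast
      ring
  · intro k hk
    rw [Finset.mem_range] at hk
    exact if_pos (by rw [hA, Finset.mem_Icc]; lia)
  · intro k hk
    rw [Finset.mem_range] at hk
    exact if_pos (by rw [hA, Finset.mem_Icc]; lia)

/-- the tail energy of the band-limited extension of a unit DPSS eigenvector
with eigenvalue `lam` equals `lam(1-lam)/W²`. -/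
theorem tailEnergy_bandlimited_dpss
    (N : ℕ) (W : ℝ) (hW : W ∈ Set.Ioo (0 : ℝ) 1)
    (s : ℤ → ℝ) (hs0 : ∀ n : ℤ, n ∉ Finset.Icc (-(N : ℤ)) (N : ℤ) → s n = 0)
    (hnorm : ∑ m ∈ Finset.Icc (-(N : ℤ)) (N : ℤ), (s m) ^ 2 = 1)
    (lam : ℝ)
    (heig : ∀ n ∈ Finset.Icc (-(N : ℤ)) (N : ℤ),
      ∑ m ∈ Finset.Icc (-(N : ℤ)) (N : ℤ), W * sinc (W * ((n : ℝ) - (m : ℝ))) * s m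
        = lam * s n)
    (b : ℤ → ℝ)
    (hb : ∀ n : ℤ, b n = ∑ m ∈ Finset.Icc (-(N : ℤ)) (N : ℤ), s m * sinc (W * ((n : ℝ) - (m : ℝ)))) :
    (∑' k : ℕ, (b (-(N : ℤ) - 1 - (k : ℤ))) ^ 2) + (∑' k : ℕ, (b ((N : ℤ) + 1 + (k : ℤ))) ^ 2)
      = lam * (1 - lam) / W ^ 2 := by
  have hW0 : W ≠ 0 := hW.1.ne'
  set A := Finset.Icc (-(N : ℤ)) (N : ℤ) with hA
  have hP := hasSum_sq_bandlimited hW A s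
  have htotal : ∑ n ∈ A, ∑ m ∈ A, s n * s m * (W * sinc (W * ((n : ℝ) - m))) = lam := by
    calc _ = ∑ n ∈ A, lam * (s n) ^ 2 := Finset.sum_congr rfl fun n hn => by
          rw [sq, ← mul_assoc, ← heig n hn, Finset.sum_mul]
          exact Finset.sum_congr rfl fun m _ => by ring
      _ = lam := by rw [← Finset.mul_sum, hnorm, mul_one]
  simp only [htotal, ← hb] at hP
  have hinner : ∑ n ∈ A, (W * b n) ^ 2 = lam ^ 2 := by
    calc _ = ∑ n ∈ A, lam ^ 2 * (s n) ^ 2 := Finset.sum_congr rfl fun n hn => by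
          rw [← mul_pow, ← heig n hn, hb, Finset.mul_sum]
          congr 1
          exact Finset.sum_congr rfl fun m _ => by ring
      _ = lam ^ 2 := by rw [← Finset.mul_sum, hnorm, mul_one]
  have h := tsum_tails_eq hP N
  rw [hinner] at h
  simp only [mul_pow, tsum_mul_left] at h
  rw [eq_div_iff (pow_ne_zero 2 hW0)]
  linear_combination h
end

section
/- Let N ∈ ℕ, W ∈ (0,1), and let s : ℤ → ℝ satisfy s[n] = 0 for n ∉ {−N,…,N} and Σ_{m=−N}^{N} s[m]² = 1. Suppose λ ∈ ℝ is such that λ·s[n] = Σ_{m=−N}^{N} W·sinc(W(n−m))·s[m] holds for all n ∈ {−N,…,N}. Define b[n] := Σ_{m=−N}^{N} s[m]·sinc(W(n−m)) for all n ∈ ℤ. Then the total energy of the band-limited extension satisfies Σ_{n∈ℤ} b[n]² = λ/W². -/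
open scoped BigOperators

/-- The integral of a character over a symmetric interval of length `W` is a sinc. -/
lemma integral_exp_two_pi_I_mul_eq_sinc {W : ℝ} (hW : 0 < W) (k : ℤ) :
    ∫ x in (-(W / 2))..(W / 2), Complex.exp (2 * Real.pi * Complex.I * k * x)
      = ((W * sinc (W * k) : ℝ) : ℂ) := by
  rcases eq_or_ne k 0 with rfl | hk
  · simp [sinc]
  · have hkR : (k : ℝ) ≠ 0 := by exact_mod_cast hk
    have hWC : (W : ℂ) ≠ 0 := by exact_mod_cast hW.ne'
    rw [integral_exp_mul_complex (by simp [hk, Real.pi_ne_zero]),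
      sinc, if_neg (mul_ne_zero hW.ne' hkR)]
    push_cast
    rw [Complex.sin]
    rw [show 2 * (Real.pi : ℂ) * Complex.I * k * (W / 2) = Real.pi * (W * k) * Complex.I by ring,
      show 2 * (Real.pi : ℂ) * Complex.I * k * -(W / 2) = -(Real.pi * (W * k)) * Complex.I by ring]
    field_simp
    rw [Complex.I_sq]
    ring

/-- The trigonometric polynomial with coefficients `s` supported on `t`. -/
noncomputable def trigPoly (t : Finset ℤ) (s : ℤ → ℝ) (x : ℝ) : ℂ :=
  ∑ m ∈ t, (s m : ℂ) * Complex.exp (2 * Real.pi * Complex.I * m * x)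

lemma continuous_trigPoly (t : Finset ℤ) (s : ℤ → ℝ) : Continuous (trigPoly t s) := by
  unfold trigPoly
  fun_prop

lemma integral_exp_neg_mul_trigPoly {W : ℝ} (hW : 0 < W) (t : Finset ℤ) (s : ℤ → ℝ) (n : ℤ) :
    ∫ x in (-(W / 2))..(W / 2),
        Complex.exp (-(2 * Real.pi * Complex.I * n * x)) * trigPoly t s x
      = ((W * ∑ m ∈ t, s m * sinc (W * ((n : ℝ) - m)) : ℝ) : ℂ) := by
  have h : ∀ x : ℝ, Complex.exp (-(2 * Real.pi * Complex.I * n * x)) * trigPoly t s x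
      = ∑ m ∈ t, (s m : ℂ) * Complex.exp (2 * Real.pi * Complex.I * ((m - n : ℤ) : ℂ) * x) := by
    intro x
    rw [trigPoly, Finset.mul_sum]
    refine Finset.sum_congr rfl fun m _ => ?_
    rw [mul_left_comm, ← Complex.exp_add]
    congr 2
    push_cast
    ring
  have sinc_neg : ∀ y : ℝ, sinc (-y) = sinc y := fun y => by simp [sinc]
  simp_rw [h]
  rw [intervalIntegral.integral_finsetSum
    (fun m _ => Continuous.intervalIntegrable (by fun_prop) _ _)]
  simp_rw [intervalIntegral.integral_const_mul, integral_exp_two_pi_I_mul_eq_sinc hW]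
  rw [Finset.mul_sum, Complex.ofReal_sum]
  refine Finset.sum_congr rfl fun m _ => ?_
  rw [← sinc_neg (W * ((n : ℝ) - m)), show -(W * ((n : ℝ) - m)) = W * ((m - n : ℤ) : ℝ) by
    push_cast; ring]
  push_cast
  ring

lemma integral_norm_trigPoly_sq {W : ℝ} (hW : 0 < W) (t : Finset ℤ) (s : ℤ → ℝ) :
    ∫ x in (-(W / 2))..(W / 2), ‖trigPoly t s x‖ ^ 2
      = ∑ n ∈ t, s n * (W * ∑ m ∈ t, s m * sinc (W * ((n : ℝ) - m))) := by
  have h : ∀ x : ℝ, ((‖trigPoly t s x‖ ^ 2 : ℝ) : ℂ)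
      = ∑ n ∈ t, (s n : ℂ) *
          (Complex.exp (-(2 * Real.pi * Complex.I * n * x)) * trigPoly t s x) := by
    intro x
    rw [Complex.ofReal_pow, ← Complex.conj_mul']
    nth_rewrite 1 [trigPoly]
    rw [map_sum, Finset.sum_mul]
    refine Finset.sum_congr rfl fun m _ => ?_
    simp [← Complex.exp_conj, mul_assoc, map_ofNat]
  have hc := continuous_trigPoly t s
  rw [← Complex.ofReal_inj, ← intervalIntegral.integral_ofReal]
  simp_rw [h]
  rw [intervalIntegral.integral_finsetSum
    (fun m _ => Continuous.intervalIntegrable (by fun_prop) _ _)]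
  simp_rw [intervalIntegral.integral_const_mul, integral_exp_neg_mul_trigPoly hW]
  push_cast
  rfl

open MeasureTheory in
lemma intervalIntegral_indicator_Ioc {E : Type*} [NormedAddCommGroup E] [NormedSpace ℝ E]
    {a b c d : ℝ} (hca : c ≤ a) (hab : a ≤ b) (hbd : b ≤ d) (g : ℝ → E) :
    ∫ x in c..d, (Set.Ioc a b).indicator g x = ∫ x in a..b, g x := by
  rw [intervalIntegral.integral_of_le (hca.trans (hab.trans hbd)),
    intervalIntegral.integral_of_le hab, setIntegral_indicator measurableSet_Ioc,
    Set.inter_eq_self_of_subset_right (Set.Ioc_subset_Ioc hca hbd)]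

open MeasureTheory in
/-- The energy of a band-limited sequence, expressed through its generating coefficients. -/
lemma hasSum_sq_sum_mul_sinc {W : ℝ} (hW : W ∈ Set.Ioo (0 : ℝ) 1) (t : Finset ℤ) (s : ℤ → ℝ) :
    HasSum (fun n : ℤ => (W * ∑ m ∈ t, s m * sinc (W * ((n : ℝ) - m))) ^ 2)
      (∑ n ∈ t, s n * (W * ∑ m ∈ t, s m * sinc (W * ((n : ℝ) - m)))) := by
  obtain ⟨hW0, hW1⟩ := hW
  have hc := continuous_trigPoly t s
  set I := Set.Ioc (-(W / 2)) (W / 2) with hI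
  have hab : (-(1 / 2) : ℝ) < 1 / 2 := by norm_num
  have hL2 : MemLp (I.indicator (trigPoly t s)) 2
      (volume.restrict (Set.Ioc (-(1 / 2) : ℝ) (1 / 2))) := by
    refine MemLp.indicator measurableSet_Ioc ?_
    obtain ⟨C, hC⟩ := isCompact_Icc.exists_bound_of_continuousOn
      (hc.continuousOn (s := Set.Icc (-(1 / 2) : ℝ) (1 / 2)))
    exact MemLp.of_bound hc.aestronglyMeasurable C <|
      (ae_restrict_mem measurableSet_Ioc).mono fun x hx => hC x (Set.Ioc_subset_Icc_self hx)
  have key := hasSum_sq_fourierCoeffOn hab hL2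
  have hsq : ∀ x, ‖I.indicator (trigPoly t s) x‖ ^ 2
      = I.indicator (fun x => ‖trigPoly t s x‖ ^ 2) x := by
    intro x
    by_cases hx : x ∈ I <;> simp [hx]
  have hcoeff : ∀ n : ℤ, fourierCoeffOn hab (I.indicator (trigPoly t s)) n
      = ((W * ∑ m ∈ t, s m * sinc (W * ((n : ℝ) - m)) : ℝ) : ℂ) := by
    intro n
    rw [fourierCoeffOn_eq_integral, ← integral_exp_neg_mul_trigPoly hW0,
      ← intervalIntegral_indicator_Ioc (a := -(W / 2)) (b := W / 2) (c := -(1 / 2)) (d := 1 / 2)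
        (by linarith) (by linarith) (by linarith), ← hI]
    norm_num only [one_smul, sub_neg_eq_add]
    refine intervalIntegral.integral_congr fun x _ => ?_
    by_cases hx : x ∈ I
    · simp only [Set.indicator_of_mem hx, fourier_coe_apply, smul_eq_mul]
      congr 2
      push_cast
      ring
    · simp only [Set.indicator_of_notMem hx, smul_zero]
  simp_rw [hsq, hcoeff] at key
  rw [intervalIntegral_indicator_Ioc (by linarith) (by linarith) (by linarith),
    integral_norm_trigPoly_sq hW0] at key
  norm_num only [one_smul, sub_neg_eq_add] at key
  simpa only [Complex.norm_real, Real.norm_eq_abs, sq_abs, one_smul] using key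

/-- the total energy of the band-limited extension of a unit DPSS eigenvector
with eigenvalue `lam` equals `lam/W²`. -/
theorem totalEnergy_bandlimited_dpss
    (N : ℕ) (W : ℝ) (hW : W ∈ Set.Ioo (0 : ℝ) 1)
    (s : ℤ → ℝ) (hs0 : ∀ n : ℤ, n ∉ Finset.Icc (-(N : ℤ)) (N : ℤ) → s n = 0)
    (hnorm : ∑ m ∈ Finset.Icc (-(N : ℤ)) (N : ℤ), (s m) ^ 2 = 1)
    (lam : ℝ)
    (heig : ∀ n ∈ Finset.Icc (-(N : ℤ)) (N : ℤ),
      ∑ m ∈ Finset.Icc (-(N : ℤ)) (N : ℤ), W * sinc (W * ((n : ℝ) - (m : ℝ))) * s m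
        = lam * s n)
    (b : ℤ → ℝ)
    (hb : ∀ n : ℤ, b n = ∑ m ∈ Finset.Icc (-(N : ℤ)) (N : ℤ), s m * sinc (W * ((n : ℝ) - (m : ℝ)))) :
    ∑' n : ℤ, (b n) ^ 2 = lam / W ^ 2 := by
  have h := hasSum_sq_sum_mul_sinc hW (Finset.Icc (-(N : ℤ)) (N : ℤ)) s
  have hsum : ∑ n ∈ Finset.Icc (-(N : ℤ)) (N : ℤ),
      s n * (W * ∑ m ∈ Finset.Icc (-(N : ℤ)) (N : ℤ), s m * sinc (W * ((n : ℝ) - m))) = lam := by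
    rw [← mul_one lam, ← hnorm, Finset.mul_sum]
    refine Finset.sum_congr rfl fun n hn => ?_
    rw [show lam * s n ^ 2 = s n * (lam * s n) by ring, ← heig n hn, Finset.mul_sum]
    congr 1
    exact Finset.sum_congr rfl fun m _ => by ring
  rw [hsum] at h
  simp_rw [← hb, mul_pow] at h
  have hW0 : W ^ 2 ≠ 0 := pow_ne_zero 2 hW.1.ne'
  rw [eq_div_iff hW0, ← h.tsum_eq, tsum_mul_left, mul_comm]
end

section
/- Let N ∈ ℕ, W ∈ (0,1), and let s : ℤ → ℝ satisfy s[n] = 0 for n ∉ {−N,…,N} and Σ_{m=−N}^{N} s[m]² = 1. Suppose λ ∈ ℝ is such that λ·s[n] = Σ_{m=−N}^{N} W·sinc(W(n−m))·s[m] holds for all n ∈ {−N,…,N}. Then the spectral concentration of s in the band [−W/2, W/2] equals the eigenvalue: ∫_{−W/2}^{W/2} |Ŝ(f)|² df = λ, where Ŝ(f) = Σ_{n=−N}^{N} s[n]·e^{−2πi f n}. -/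
open scoped BigOperators

lemma norm_sum_mul_exp_sq (S : Finset ℤ) (s : ℤ → ℝ) (f : ℝ) :
    ‖∑ n ∈ S, (s n : ℂ) *
        Complex.exp (-2 * (Real.pi : ℂ) * Complex.I * (f : ℂ) * (n : ℂ))‖ ^ 2
      = ∑ n ∈ S, ∑ m ∈ S, s n * s m * Real.cos (2 * Real.pi * ((n : ℝ) - m) * f) := by
  have hexp : ∀ n : ℤ, Complex.exp (-2 * (Real.pi : ℂ) * Complex.I * (f : ℂ) * (n : ℂ))
      = Complex.exp (((-(2 * Real.pi * n * f) : ℝ) : ℂ) * Complex.I) := fun n ↦ by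
    congr 1
    push_cast
    ring
  simp only [hexp]
  rw [← Complex.normSq_eq_norm_sq, Complex.normSq_apply, Complex.re_sum, Complex.im_sum]
  simp only [Complex.re_ofReal_mul, Complex.im_ofReal_mul, Complex.exp_ofReal_mul_I_re,
    Complex.exp_ofReal_mul_I_im, Real.cos_neg, Real.sin_neg]
  rw [Finset.sum_mul_sum, Finset.sum_mul_sum, ← Finset.sum_add_distrib]
  refine Finset.sum_congr rfl fun n _ ↦ ?_
  rw [← Finset.sum_add_distrib]
  refine Finset.sum_congr rfl fun m _ ↦ ?_
  rw [show 2 * Real.pi * ((n : ℝ) - m) * f = 2 * Real.pi * n * f - 2 * Real.pi * m * f by ring,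
    Real.cos_sub]
  ring

lemma integral_cos_two_pi_mul (W k : ℝ) (hW : W ≠ 0) :
    ∫ f in (-(W / 2))..(W / 2), Real.cos (2 * Real.pi * k * f) = W * sinc (W * k) := by
  by_cases hk : k = 0
  · simp [hk, sinc]
  · have hc : 2 * Real.pi * k ≠ 0 := by positivity
    rw [intervalIntegral.integral_comp_mul_left _ hc, integral_cos, sinc,
      if_neg (mul_ne_zero hW hk), mul_neg, Real.sin_neg,
      show 2 * Real.pi * k * (W / 2) = Real.pi * (W * k) by ring, smul_eq_mul]
    field_simp
    ring

/-- the spectral concentration of a unit DPSS eigenvector in the band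
`[-W/2, W/2]` equals its eigenvalue. -/
theorem spectral_concentration_eq_eigenvalue
    (N : ℕ) (W : ℝ) (hW : W ∈ Set.Ioo (0 : ℝ) 1)
    (s : ℤ → ℝ) (hs0 : ∀ n : ℤ, n ∉ Finset.Icc (-(N : ℤ)) (N : ℤ) → s n = 0)
    (hnorm : ∑ m ∈ Finset.Icc (-(N : ℤ)) (N : ℤ), (s m) ^ 2 = 1)
    (lam : ℝ)
    (heig : ∀ n ∈ Finset.Icc (-(N : ℤ)) (N : ℤ),
      ∑ m ∈ Finset.Icc (-(N : ℤ)) (N : ℤ), W * sinc (W * ((n : ℝ) - (m : ℝ))) * s m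
        = lam * s n) :
    ∫ f in (-(W/2))..(W/2),
        ‖∑ n ∈ Finset.Icc (-(N : ℤ)) (N : ℤ),
            (s n : ℂ) * Complex.exp (-2 * (Real.pi : ℂ) * Complex.I * (f : ℂ) * (n : ℂ))‖ ^ 2
      = lam := by
  simp only [norm_sum_mul_exp_sq]
  have hint : ∀ n m : ℤ, IntervalIntegrable
      (fun f : ℝ ↦ s n * s m * Real.cos (2 * Real.pi * ((n : ℝ) - m) * f))
      MeasureTheory.volume (-(W / 2)) (W / 2) := fun n m ↦
    Continuous.intervalIntegrable (by fun_prop) _ _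
  rw [intervalIntegral.integral_finsetSum fun n _ ↦
    Continuous.intervalIntegrable (by fun_prop) _ _]
  calc
    _ = ∑ n ∈ Finset.Icc (-(N : ℤ)) (N : ℤ), lam * s n ^ 2 := by
      refine Finset.sum_congr rfl fun n hn ↦ ?_
      rw [intervalIntegral.integral_finsetSum fun m _ ↦ hint n m, sq, ← mul_assoc,
        ← heig n hn, Finset.sum_mul]
      refine Finset.sum_congr rfl fun m _ ↦ ?_
      rw [intervalIntegral.integral_const_mul, integral_cos_two_pi_mul _ _ hW.1.ne']
      ring
    _ = lam := by rw [← Finset.mul_sum, hnorm, mul_one]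
end

section
/- Let N be an even positive integer and let r, s ∈ {0, 1, …, N} with r ≠ s. Then for every integer p with 0 ≤ p ≤ N, the cross-correlation of the frequency-domain sub-waveforms admits the closed form (1/(N+1)) · Σ_{n=p−N/2}^{N/2} e^{−2πi r n/(N+1)} · e^{2πi s (n−p)/(N+1)} = (1/(N+1)) · e^{−πi (r+s) p/(N+1)} · sin(π(r−s)(N−p+1)/(N+1)) / sin(π(r−s)/(N+1)). -/
open scoped BigOperators

/-- Dirichlet-kernel identity: a geometric sum of exponentials with step `-2 * z * I`,
multiplied by `sin z`, as a phase at the midpoint times a sine. -/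
theorem sin_mul_sum_range_exp (z a : ℂ) (K : ℕ) :
    Complex.sin z * ∑ k ∈ Finset.range K, Complex.exp (-(2 * z * (a + k)) * Complex.I) =
      Complex.exp (-(z * (2 * a + K - 1)) * Complex.I) * Complex.sin (K * z) := by
  have hterm (k : ℕ) :
      Complex.sin z * Complex.exp (-(2 * z * (a + k)) * Complex.I) =
        (Complex.exp (-(z * (2 * a + 2 * (k + 1 : ℕ) - 1)) * Complex.I) -
          Complex.exp (-(z * (2 * a + 2 * k - 1)) * Complex.I)) * (Complex.I / 2) := by
    have h1 : -(z * (2 * a + 2 * (k + 1 : ℕ) - 1)) * Complex.I =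
        -z * Complex.I + -(2 * z * (a + k)) * Complex.I := by push_cast; ring
    have h2 : -(z * (2 * a + 2 * k - 1)) * Complex.I =
        z * Complex.I + -(2 * z * (a + k)) * Complex.I := by ring
    rw [h1, h2, Complex.exp_add, Complex.exp_add, Complex.sin]
    ring
  rw [Finset.mul_sum, Finset.sum_congr rfl fun k _ => hterm k, ← Finset.sum_mul,
    Finset.sum_range_sub fun k : ℕ =>
      Complex.exp (-(z * (2 * a + 2 * (k : ℂ) - 1)) * Complex.I)]
  have h1 : -(z * (2 * a + 2 * K - 1)) * Complex.I =
      -(z * (2 * a + K - 1)) * Complex.I + -(K * z) * Complex.I := by ring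
  have h2 : -(z * (2 * a + 2 * (0 : ℕ) - 1)) * Complex.I =
      -(z * (2 * a + K - 1)) * Complex.I + K * z * Complex.I := by push_cast; ring
  rw [h1, h2, Complex.exp_add, Complex.exp_add, Complex.sin]
  ring

/-- A sum over an integer interval of `K` points starting at `a`, reindexed by
`Finset.range K`. -/
theorem sum_Icc_int_eq_sum_range {M : Type*} [AddCommMonoid M] (f : ℤ → M) (a b : ℤ) (K : ℕ)
    (h : a + K = b + 1) :
    ∑ n ∈ Finset.Icc a b, f n = ∑ k ∈ Finset.range K, f (a + k) := by
  symm
  refine Finset.sum_bij (fun k _ => a + (k : ℤ)) ?_ ?_ ?_ fun _ _ => rfl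
  · intro k hk
    rw [Finset.mem_range] at hk
    rw [Finset.mem_Icc]
    omega
  · intro k _ l _ hkl
    omega
  · intro n hn
    rw [Finset.mem_Icc] at hn
    exact ⟨(n - a).toNat, by rw [Finset.mem_range]; omega, by omega⟩

/-- `sin (π x / y)` does not vanish when `0 < |x| < y`. -/
theorem sin_pi_mul_div_ne_zero {x y : ℝ} (hx : x ≠ 0) (hxy : |x| < y) :
    Real.sin (Real.pi * x / y) ≠ 0 := by
  have hy : 0 < y := (abs_nonneg x).trans_lt hxy
  obtain ⟨hl, hu⟩ := abs_lt.mp hxy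
  have hlow : -Real.pi < Real.pi * x / y := by
    rw [lt_div_iff₀ hy]
    nlinarith [Real.pi_pos]
  have hupp : Real.pi * x / y < Real.pi := by
    rw [div_lt_iff₀ hy]
    nlinarith [Real.pi_pos]
  rw [Ne, Real.sin_eq_zero_iff_of_lt_of_lt hlow hupp]
  exact div_ne_zero (mul_ne_zero Real.pi_ne_zero hx) (ne_of_gt hy)

/-- closed form for the cross-correlation of frequency-domain sub-waveforms
(sub-carriers) at nonnegative lag `p`. -/
theorem freq_domain_crosscorrelation_closed_form
    (N : ℕ) (hN : 0 < N) (hNe : Even N)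
    (r s : ℕ) (hr : r ≤ N) (hs : s ≤ N) (hrs : r ≠ s)
    (p : ℕ) (hp : p ≤ N) :
    (1 / ((N : ℂ) + 1)) *
        ∑ n ∈ Finset.Icc ((p : ℤ) - (N : ℤ)/2) ((N : ℤ)/2),
          Complex.exp (-2 * (Real.pi : ℂ) * Complex.I * (r : ℂ) * (n : ℂ) / ((N : ℂ) + 1)) *
          Complex.exp (2 * (Real.pi : ℂ) * Complex.I * (s : ℂ) * ((n : ℂ) - (p : ℂ)) / ((N : ℂ) + 1))
      = (1 / ((N : ℂ) + 1)) *
          Complex.exp (-(Real.pi : ℂ) * Complex.I * ((r : ℂ) + (s : ℂ)) * (p : ℂ) / ((N : ℂ) + 1)) *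
          ((Real.sin (Real.pi * ((r : ℝ) - (s : ℝ)) * ((N : ℝ) - (p : ℝ) + 1) / ((N : ℝ) + 1)) /
              Real.sin (Real.pi * ((r : ℝ) - (s : ℝ)) / ((N : ℝ) + 1)) : ℝ) : ℂ) := by
  have hsin : Real.sin (Real.pi * ((r : ℝ) - (s : ℝ)) / ((N : ℝ) + 1)) ≠ 0 := by
    refine sin_pi_mul_div_ne_zero (sub_ne_zero.mpr (Nat.cast_injective.ne hrs)) ?_
    have hr' : (r : ℝ) ≤ N := Nat.cast_le.mpr hr
    have hs' : (s : ℝ) ≤ N := Nat.cast_le.mpr hs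
    have hr0 : (0 : ℝ) ≤ r := r.cast_nonneg
    have hs0 : (0 : ℝ) ≤ s := s.cast_nonneg
    rw [abs_lt]
    constructor <;> linarith
  have hsinC : Complex.sin (Real.pi * ((r : ℂ) - s) / ((N : ℂ) + 1)) ≠ 0 := by
    exact_mod_cast hsin
  obtain ⟨M, rfl⟩ := hNe
  obtain ⟨q, hq⟩ := Nat.exists_eq_add_of_le hp
  have hqC : (M : ℂ) + M = p + q := by exact_mod_cast hq
  have hhalf : ((M + M : ℕ) : ℤ) / 2 = M := by omega
  rw [mul_assoc (1 / _) (Complex.exp _), hhalf, sum_Icc_int_eq_sum_range _ _ _ (q + 1) (by omega)]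
  congr 1
  have hkernel := sin_mul_sum_range_exp
    (Real.pi * ((r : ℂ) - s) / (((M + M : ℕ) : ℂ) + 1)) ((p : ℂ) - M) (q + 1)
  push_cast at hkernel hsinC ⊢
  rw [mul_div_assoc', eq_div_iff hsinC, mul_comm]
  have hterm (k : ℕ) :
      Complex.exp (-2 * Real.pi * Complex.I * r * ((p : ℂ) - M + k) / ((M : ℂ) + M + 1)) *
        Complex.exp (2 * Real.pi * Complex.I * s * ((p : ℂ) - M + k - p) / ((M : ℂ) + M + 1)) =
      Complex.exp (-(2 * Real.pi * Complex.I * s * p / ((M : ℂ) + M + 1))) *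
        Complex.exp (-(2 * (Real.pi * ((r : ℂ) - s) / ((M : ℂ) + M + 1)) * ((p : ℂ) - M + k)) *
          Complex.I) := by
    rw [← Complex.exp_add, ← Complex.exp_add]
    congr 1
    ring
  rw [Finset.sum_congr rfl fun k _ => hterm k, ← Finset.mul_sum, mul_left_comm, hkernel,
    ← mul_assoc, ← Complex.exp_add]
  congr 2
  · have hmid : 2 * ((p : ℂ) - M) + (q + 1) - 1 = p := by linear_combination -hqC
    rw [hmid]
    ring
  · have hlen : (M : ℂ) + M - p + 1 = q + 1 := by linear_combination hqC
    rw [hlen]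
    ring
end
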